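/- Let n ≥ 2, q ∈ [0,n), λ > 0, and let Ω ⊆ ℝⁿ be an open convex set. Let w : Ω → ℝ be continuous, convex and nonnegative, and suppose that |∂w(E ∩ {w>0})| ≥ λ ∫_{E∩{w>0}} w^q dx for every Borel set E ⊆ Ω. Let K := {x ∈ Ω : w(x) = 0}. If K is nonempty and has Lebesgue measure zero, then the dimension of the affine span of K is at most (n+q)/2. -/

import Mathlib

open MeasureTheory Set Metric
open scoped RealInnerProductSpace

noncomputable section

/-- The subdifferential of a convex function `v` at `x`, relative to the domain `Ω`. -/
def subgrad {n : ℕ} (Ω : Set (EuclideanSpace ℝ (Fin n))) (v : EuclideanSpace ℝ (Fin n) → ℝ)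
    (x : EuclideanSpace ℝ (Fin n)) : Set (EuclideanSpace ℝ (Fin n)) :=
  {p | ∀ y ∈ Ω, v x + ⟪p, y - x⟫ ≤ v y}

/-- The image `∂v(E) = ⋃_{x ∈ E} ∂v(x)` of a set under the subdifferential. -/
def subgradImg {n : ℕ} (Ω : Set (EuclideanSpace ℝ (Fin n))) (v : EuclideanSpace ℝ (Fin n) → ℝ)
    (E : Set (EuclideanSpace ℝ (Fin n))) : Set (EuclideanSpace ℝ (Fin n)) :=
  ⋃ x ∈ E, subgrad Ω v x

/-- The last coordinate `x_n` of a point of `ℝⁿ`. -/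
def lastCoord {n : ℕ} (x : EuclideanSpace ℝ (Fin n)) : ℝ :=
  if h : 0 < n then x ⟨n - 1, by omega⟩ else 0

/-- The first `n-1` coordinates `x'` of a point of `ℝⁿ`. -/
def fstCoords {n : ℕ} (x : EuclideanSpace ℝ (Fin n)) : EuclideanSpace ℝ (Fin (n - 1)) :=
  (EuclideanSpace.equiv (Fin (n - 1)) ℝ).symm
    (fun i => x ⟨i, lt_of_lt_of_le i.isLt (Nat.sub_le n 1)⟩)

/-- The point `(x', t) ∈ ℝⁿ = ℝ^{n-1} × ℝ`. -/
def app (n : ℕ) (x' : EuclideanSpace ℝ (Fin (n - 1))) (t : ℝ) : EuclideanSpace ℝ (Fin n) :=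
  (EuclideanSpace.equiv (Fin n) ℝ).symm
    (fun i => if h : (i : ℕ) < n - 1 then x' ⟨i, h⟩ else t)


section NondegeneracyEstimate

variable {n : ℕ} {Ω : Set (EuclideanSpace ℝ (Fin n))} {w : EuclideanSpace ℝ (Fin n) → ℝ}
  {T : EuclideanSpace ℝ (Fin n) →ₗ[ℝ] EuclideanSpace ℝ (Fin n)}

/-- If `0 ≤ w` on `A` and `w ≤ S` on the ellipsoids `z + T (closedBall 0 δ)`, `z ∈ A`, then `∂w(A)`
is contained in a dual ellipsoid. -/
lemma volume_subgradImg_le (hT : T.IsSymmetric) (hdet : LinearMap.det T ≠ 0)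
    {A : Set (EuclideanSpace ℝ (Fin n))} {δ S : ℝ} (hδ : 0 < δ) (hS : 0 ≤ S)
    (hA : ∀ z ∈ A, 0 ≤ w z)
    (hAS : ∀ z ∈ A, ∀ v, ‖v‖ ≤ δ → z + T v ∈ Ω ∧ w (z + T v) ≤ S) :
    volume (subgradImg Ω w A) ≤
      ENNReal.ofReal (|LinearMap.det T|⁻¹ * (S / δ) ^ n) *
        volume (ball (0 : EuclideanSpace ℝ (Fin n)) 1) := by
  have hsub : subgradImg Ω w A ⊆ T ⁻¹' closedBall 0 (S / δ) := by
    intro p hp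
    simp only [subgradImg, mem_iUnion] at hp
    obtain ⟨z, hz, hp⟩ := hp
    rw [mem_preimage, mem_closedBall_zero_iff, le_div_iff₀ hδ]
    by_cases h0 : ‖T p‖ = 0
    · simpa [h0] using hS
    have hpos : 0 < ‖T p‖ := lt_of_le_of_ne (norm_nonneg _) (Ne.symm h0)
    have hv : ‖(δ / ‖T p‖) • T p‖ ≤ δ := by
      rw [norm_smul, Real.norm_eq_abs, abs_of_pos (div_pos hδ hpos), div_mul_cancel₀ _ h0]
    obtain ⟨hmem, hle⟩ := hAS z hz _ hv
    have h1 := hp _ hmem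
    rw [add_sub_cancel_left, ← hT, real_inner_smul_right, real_inner_self_eq_norm_sq] at h1
    have h2 : δ / ‖T p‖ * ‖T p‖ ^ 2 = ‖T p‖ * δ := by field_simp
    have := hA z hz
    linarith
  refine (measure_mono hsub).trans ?_
  rw [Measure.addHaar_preimage_linearMap _ hdet, Measure.addHaar_closedBall _ _ (by positivity),
    ← mul_assoc, ← ENNReal.ofReal_mul (by positivity), abs_inv, finrank_euclideanSpace_fin]

/-- A convex function is at least its central value on half of any ellipsoid. -/
lemma volume_le_two_mul_volume_superlevel (hconv : ConvexOn ℝ Ω w) (hcont : ContinuousOn w Ω)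
    {c x : EuclideanSpace ℝ (Fin n)} {ρ : ℝ}
    (hN : (fun v => c + T v) '' closedBall x ρ ⊆ Ω) :
    MeasurableSet ((fun v => c + T v) '' closedBall x ρ ∩ {y | w (c + T x) ≤ w y}) ∧
    volume ((fun v => c + T v) '' closedBall x ρ) ≤
      2 * volume ((fun v => c + T v) '' closedBall x ρ ∩ {y | w (c + T x) ≤ w y}) := by
  set N := (fun v => c + T v) '' closedBall x ρ with hNdef
  have hTc : Continuous T := T.continuous_of_finiteDimensional
  have hNc : IsCompact N := (isCompact_closedBall x ρ).image (by fun_prop)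
  have hmeas : MeasurableSet (N ∩ {y | w (c + T x) ≤ w y}) :=
    ((hcont.mono hN).preimage_isClosed_of_isClosed hNc.isClosed isClosed_Ici).measurableSet
  refine ⟨hmeas, ?_⟩
  set G := N ∩ {y | w (c + T x) ≤ w y} with hG
  set e := c + T x with he
  have hcover : N ⊆ G ∪ (fun y => (e + e) - y) ⁻¹' G := by
    intro y hy
    have hy' : (e + e) - y ∈ N := by
      obtain ⟨v, hv, rfl⟩ := hy
      refine ⟨(x + x) - v, ?_, ?_⟩
      · rw [mem_closedBall, dist_eq_norm] at hv ⊢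
        rwa [show x + x - v - x = -(v - x) by abel, norm_neg]
      · simp only [he, map_sub, map_add]
        abel
    by_cases h : e ∈ N ∧ w e ≤ w y
    · exact Or.inl ⟨hy, h.2⟩
    refine Or.inr ⟨hy', ?_⟩
    have hmid := hconv.2 (hN hy) (hN hy') (by norm_num : (0 : ℝ) ≤ 1 / 2)
      (by norm_num : (0 : ℝ) ≤ 1 / 2) (by norm_num)
    have heq : (1 / 2 : ℝ) • y + (1 / 2 : ℝ) • ((e + e) - y) = e := by
      module
    rw [heq] at hmid
    have heN : e ∈ N := by
      obtain ⟨v, hv, _⟩ := hy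
      exact ⟨x, mem_closedBall_self (dist_nonneg.trans hv), rfl⟩
    have : ¬ w e ≤ w y := fun h' => h ⟨heN, h'⟩
    simp only [smul_eq_mul] at hmid
    change w e ≤ w (e + e - y)
    linarith
  calc volume N ≤ volume (G ∪ (fun y => (e + e) - y) ⁻¹' G) := measure_mono hcover
    _ ≤ volume G + volume ((fun y => (e + e) - y) ⁻¹' G) := measure_union_le _ _
    _ = 2 * volume G := by
      rw [(Measure.measurePreserving_sub_left volume (e + e)).measure_preimage
        hmeas.nullMeasurableSet, two_mul]

lemma volume_affine_image_closedBall (c x : EuclideanSpace ℝ (Fin n)) {ρ : ℝ} (hρ : 0 ≤ ρ) :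
    volume ((fun v => c + T v) '' closedBall x ρ) =
      ENNReal.ofReal (|LinearMap.det T| * ρ ^ n) *
        volume (ball (0 : EuclideanSpace ℝ (Fin n)) 1) := by
  have : (fun v => c + T v) '' closedBall x ρ = (fun y => -c + y) ⁻¹' (T '' closedBall x ρ) := by
    rw [← Set.image_add_left, image_image]
  rw [this, measure_preimage_add, Measure.addHaar_image_linearMap,
    Measure.addHaar_closedBall _ _ hρ, ← mul_assoc, ← ENNReal.ofReal_mul (abs_nonneg _),
    finrank_euclideanSpace_fin]

/-- The two-sided measure estimate on an ellipsoid in which `w` is at most `Q` times its central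
value. -/
lemma det_sq_mul_pow_le {q lam : ℝ} (hq0 : 0 ≤ q) (hlam : 0 < lam)
    (hcont : ContinuousOn w Ω) (hconv : ConvexOn ℝ Ω w) (hnonneg : ∀ x ∈ Ω, 0 ≤ w x)
    (hMA : ∀ E : Set (EuclideanSpace ℝ (Fin n)), MeasurableSet E → E ⊆ Ω →
      ENNReal.ofReal lam * ∫⁻ x in E ∩ {x | 0 < w x}, ENNReal.ofReal (w x ^ q) ≤
        volume (subgradImg Ω w (E ∩ {x | 0 < w x})))
    (hT : T.IsSymmetric) (hdet : LinearMap.det T ≠ 0)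
    {c x : EuclideanSpace ℝ (Fin n)} {d Q : ℝ} (hd : 0 < d) (hQ : 0 < Q)
    (hw : 0 < w (c + T x))
    (hle : ∀ v ∈ closedBall x d, c + T v ∈ Ω ∧ w (c + T v) ≤ Q * w (c + T x)) :
    lam * |LinearMap.det T| ^ 2 * d ^ (2 * n) ≤ 2 * (4 * Q) ^ n * w (c + T x) ^ (n - q) := by
  set M := w (c + T x) with hM
  set D := |LinearMap.det T| with hD
  have hDpos : 0 < D := abs_pos.2 hdet
  set N := (fun v => c + T v) '' closedBall x (d / 2) with hNdef
  have hNΩ : N ⊆ Ω := by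
    rintro _ ⟨v, hv, rfl⟩
    exact (hle v (closedBall_subset_closedBall (by linarith) hv)).1
  have hTc : Continuous T := T.continuous_of_finiteDimensional
  have hNc : IsCompact N := (isCompact_closedBall x (d / 2)).image (by fun_prop)
  obtain ⟨hGm, hG⟩ := volume_le_two_mul_volume_superlevel hconv hcont hNΩ
  set G := N ∩ {y | M ≤ w y} with hGdef
  set ω := volume (ball (0 : EuclideanSpace ℝ (Fin n)) 1) with hω
  have hω0 : ω ≠ 0 := (measure_ball_pos volume _ one_pos).ne'
  have hωt : ω ≠ ⊤ := measure_ball_lt_top.ne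
  have hupper : volume (subgradImg Ω w (N ∩ {x | 0 < w x})) ≤
      ENNReal.ofReal (D⁻¹ * (Q * M / (d / 2)) ^ n) * ω := by
    refine volume_subgradImg_le hT hdet (half_pos hd) (by positivity)
      (fun z hz => hnonneg z (hNΩ hz.1)) ?_
    rintro _ ⟨⟨u, hu, rfl⟩, -⟩ v hv
    have hmem : u + v ∈ closedBall x d := by
      rw [mem_closedBall, dist_eq_norm] at hu ⊢
      calc ‖u + v - x‖ = ‖(u - x) + v‖ := by congr 1; abel
        _ ≤ ‖u - x‖ + ‖v‖ := norm_add_le _ _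
        _ ≤ d := by linarith
    have := hle _ hmem
    simpa [add_assoc] using this
  have hlower : ENNReal.ofReal (M ^ q) * volume G ≤
      ∫⁻ x in N ∩ {x | 0 < w x}, ENNReal.ofReal (w x ^ q) := by
    rw [← setLIntegral_const]
    refine (setLIntegral_mono' hGm fun y hy => ?_).trans
      (lintegral_mono_set fun y hy => ⟨hy.1, hw.trans_le hy.2⟩)
    exact ENNReal.ofReal_le_ofReal (Real.rpow_le_rpow hw.le hy.2 hq0)
  have hvol : volume N = ENNReal.ofReal (D * (d / 2) ^ n) * ω :=
    volume_affine_image_closedBall c x (half_pos hd).le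
  have hchain : ENNReal.ofReal (lam * M ^ q * (D * (d / 2) ^ n)) * ω ≤
      ENNReal.ofReal (2 * (D⁻¹ * (Q * M / (d / 2)) ^ n)) * ω := by
    have hMq : 0 ≤ M ^ q := Real.rpow_nonneg hw.le q
    calc ENNReal.ofReal (lam * M ^ q * (D * (d / 2) ^ n)) * ω
        = ENNReal.ofReal lam * (ENNReal.ofReal (M ^ q) * volume N) := by
          rw [hvol, ENNReal.ofReal_mul (by positivity), ENNReal.ofReal_mul hlam.le]
          ring
      _ ≤ ENNReal.ofReal lam * (ENNReal.ofReal (M ^ q) * (2 * volume G)) := by gcongr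
      _ = 2 * (ENNReal.ofReal lam * (ENNReal.ofReal (M ^ q) * volume G)) := by ring
      _ ≤ 2 * (ENNReal.ofReal (D⁻¹ * (Q * M / (d / 2)) ^ n) * ω) := by
          exact mul_le_mul_right ((mul_le_mul_right hlower _).trans
            ((hMA N hNc.measurableSet hNΩ).trans hupper)) 2
      _ = _ := by
          rw [ENNReal.ofReal_mul zero_le_two, ENNReal.ofReal_ofNat, mul_assoc]
  rw [ENNReal.mul_le_mul_iff_left hω0 hωt, ENNReal.ofReal_le_ofReal_iff (by positivity)] at hchain
  have hMqpos : 0 < M ^ q := Real.rpow_pos_of_pos hw q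
  rw [Real.rpow_sub hw, Real.rpow_natCast, ← mul_div_assoc, le_div_iff₀ hMqpos]
  have h1 := mul_le_mul_of_nonneg_left hchain (by positivity : 0 ≤ D * (2 * d) ^ n)
  have e1 : D * (2 * d) ^ n * (lam * M ^ q * (D * (d / 2) ^ n)) =
      lam * D ^ 2 * d ^ (2 * n) * M ^ q := by
    have : (2 * d) ^ n * (d / 2) ^ n = d ^ (2 * n) := by
      rw [← mul_pow, pow_mul]; congr 1; ring
    rw [← this]; ring
  have e2 : D * (2 * d) ^ n * (2 * (D⁻¹ * (Q * M / (d / 2)) ^ n)) =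
      2 * (4 * Q) ^ n * M ^ n := by
    have : (2 * d) ^ n * (Q * M / (d / 2)) ^ n = (4 * Q) ^ n * M ^ n := by
      rw [← mul_pow, ← mul_pow]; congr 1; field_simp; ring
    calc _ = (D * D⁻¹) * 2 * ((2 * d) ^ n * (Q * M / (d / 2)) ^ n) := by ring
      _ = _ := by rw [this, mul_inv_cancel₀ hDpos.ne']; ring
  rwa [e1, e2] at h1

/-- Nondegeneracy: on an ellipsoid `c + T (closedBall 0 1)` centred at a positivity point, the
maximum of `w` is bounded below by a power of the volume. -/
lemma exists_rpow_det_le {q lam : ℝ} (hn : n ≠ 0) (hq0 : 0 ≤ q) (hqn : q < n) (hlam : 0 < lam)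
    (hcont : ContinuousOn w Ω) (hconv : ConvexOn ℝ Ω w) (hnonneg : ∀ x ∈ Ω, 0 ≤ w x)
    (hMA : ∀ E : Set (EuclideanSpace ℝ (Fin n)), MeasurableSet E → E ⊆ Ω →
      ENNReal.ofReal lam * ∫⁻ x in E ∩ {x | 0 < w x}, ENNReal.ofReal (w x ^ q) ≤
        volume (subgradImg Ω w (E ∩ {x | 0 < w x}))) :
    ∃ C > 0, ∀ (T : EuclideanSpace ℝ (Fin n) →ₗ[ℝ] EuclideanSpace ℝ (Fin n))
      (c : EuclideanSpace ℝ (Fin n)), T.IsSymmetric → LinearMap.det T ≠ 0 → 0 < w c →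
      (∀ v ∈ closedBall 0 1, c + T v ∈ Ω) →
      ∃ x ∈ closedBall 0 1,
        C * |LinearMap.det T| ^ (1 / n : ℝ) ≤ w (c + T x) ^ ((n - q) / (2 * n)) := by
  have hnpos : (0 : ℝ) < n := by positivity
  set θ : ℝ := (n - q) / (2 * n) with hθ
  have hθpos : 0 < θ := div_pos (sub_pos.2 hqn) (by positivity)
  set Q : ℝ := 2 ^ (1 / θ) with hQ
  have hQpos : 0 < Q := by positivity
  set B : ℝ := lam / (2 * (4 * Q) ^ n) with hB
  have hBpos : 0 < B := by positivity
  set b : ℝ := B ^ (1 / (2 * n) : ℝ) with hb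
  have hbpos : 0 < b := by positivity
  refine ⟨b / 3, by positivity, fun T c hT hdet hwc hΩ => ?_⟩
  have hDpos : 0 < |LinearMap.det T| := abs_pos.2 hdet
  set a : ℝ := b * |LinearMap.det T| ^ (1 / n : ℝ) with ha
  have hapos : 0 < a := by positivity
  have hTc : Continuous T := T.continuous_of_finiteDimensional
  set g : EuclideanSpace ℝ (Fin n) → ℝ := fun x => w (c + T x) ^ θ with hg
  have core : ∀ x d, 0 < d → closedBall x d ⊆ closedBall 0 1 → 0 < g x →
      (∀ v ∈ closedBall x d, g v ≤ 2 * g x) → a * d ≤ g x := by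
    intro x d hd hsub hgx hle
    have hxΩ := hΩ x (hsub (mem_closedBall_self hd.le))
    have hwx : 0 < w (c + T x) := by
      refine lt_of_le_of_ne (hnonneg _ hxΩ) fun h => ?_
      simp [hg, ← h, Real.zero_rpow hθpos.ne'] at hgx
    have key := det_sq_mul_pow_le hq0 hlam hcont hconv hnonneg hMA hT hdet hd hQpos hwx
      (fun v hv => ⟨hΩ v (hsub hv), by
        have h1 : w (c + T v) ^ θ ≤ (Q * w (c + T x)) ^ θ := by
          rw [Real.mul_rpow hQpos.le hwx.le, hQ, ← Real.rpow_mul zero_le_two,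
            one_div_mul_cancel hθpos.ne', Real.rpow_one]
          exact hle v hv
        exact (Real.rpow_le_rpow_iff (hnonneg _ (hΩ v (hsub hv))) (by positivity) hθpos).1 h1⟩)
    have key2 : B * |LinearMap.det T| ^ 2 * d ^ (2 * n) ≤ w (c + T x) ^ (n - q) := by
      have hpos : 0 < 2 * (4 * Q) ^ n := by positivity
      rw [hB, div_mul_eq_mul_div, div_mul_eq_mul_div, div_le_iff₀ hpos]
      linarith
    have key3 := Real.rpow_le_rpow (by positivity) key2 (by positivity : (0 : ℝ) ≤ 1 / (2 * n))
    rw [Real.mul_rpow (by positivity) (by positivity), Real.mul_rpow (by positivity) (by positivity),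
      ← Real.rpow_mul hwx.le, ← Real.rpow_natCast, ← Real.rpow_natCast, ← Real.rpow_mul hDpos.le,
      ← Real.rpow_mul hd.le] at key3
    have e1 : ((2 : ℕ) : ℝ) * (1 / (2 * n)) = 1 / n := by push_cast; field_simp
    have e2 : ((2 * n : ℕ) : ℝ) * (1 / (2 * n)) = 1 := by push_cast; field_simp
    have e3 : ((n : ℝ) - q) * (1 / (2 * n)) = θ := by rw [hθ]; ring
    rwa [e1, e2, e3, Real.rpow_one] at key3
  have hgcont : ContinuousOn (fun x => g x - a / 2 * ‖x‖) (closedBall 0 1) := by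
    refine ContinuousOn.sub (ContinuousOn.rpow_const ?_ fun _ _ => Or.inr hθpos.le) (by fun_prop)
    exact hcont.comp (by fun_prop) hΩ
  obtain ⟨x, hx, hmax⟩ := (isCompact_closedBall (0 : EuclideanSpace ℝ (Fin n)) 1).exists_isMaxOn
    ⟨0, mem_closedBall_self zero_le_one⟩ hgcont
  have hmax' : ∀ v ∈ closedBall (0 : EuclideanSpace ℝ (Fin n)) 1,
      g v - a / 2 * ‖v‖ ≤ g x - a / 2 * ‖x‖ := fun v hv => hmax hv
  refine ⟨x, hx, ?_⟩
  change b / 3 * |LinearMap.det T| ^ (1 / n : ℝ) ≤ g x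
  suffices a / 3 ≤ g x by
    refine le_trans (le_of_eq ?_) this
    rw [ha]; ring
  have hg0 : 0 < g 0 := by
    simp only [hg, map_zero, add_zero]
    positivity
  have h0 := hmax' 0 (mem_closedBall_self zero_le_one)
  rw [norm_zero, mul_zero, sub_zero] at h0
  have hgx : 0 < g x := by nlinarith [norm_nonneg x]
  have hx1 : ‖x‖ ≤ 1 := by simpa using hx
  rcases hx1.eq_or_lt with hx1 | hx1
  · rw [hx1] at h0
    linarith
  set d := min (1 - ‖x‖) (g x / (a / 2)) with hd
  have hdpos : 0 < d := lt_min (by linarith) (by positivity)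
  have hdx : a / 2 * d ≤ g x := by
    have := min_le_right (1 - ‖x‖) (g x / (a / 2))
    rwa [← hd, le_div_iff₀' (by positivity)] at this
  have hsub : closedBall x d ⊆ closedBall 0 1 := by
    refine closedBall_subset_closedBall' ?_
    rw [dist_zero_right]
    linarith [min_le_left (1 - ‖x‖) (g x / (a / 2))]
  have hcore := core x d hdpos hsub hgx fun v hv => by
    have h1 := hmax' v (hsub hv)
    rw [mem_closedBall, dist_eq_norm] at hv
    have h2 : ‖v‖ - ‖x‖ ≤ d := (norm_sub_norm_le v x).trans hv
    nlinarith
  rcases le_total (1 - ‖x‖) (g x / (a / 2)) with h | h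
  · rw [hd, min_eq_left h] at hcore
    nlinarith
  · rw [hd, min_eq_right h] at hcore
    have : a * (g x / (a / 2)) = 2 * g x := by field_simp
    linarith

end NondegeneracyEstimate

section Anisotropic

variable {n : ℕ} (V : Submodule ℝ (EuclideanSpace ℝ (Fin n)))

/-- The symmetric map acting as `r` on `V` and as `h` on its orthogonal complement. -/
def anisotropicScaling (r h : ℝ) : EuclideanSpace ℝ (Fin n) →ₗ[ℝ] EuclideanSpace ℝ (Fin n) :=
  r • (V.starProjection : EuclideanSpace ℝ (Fin n) →ₗ[ℝ] EuclideanSpace ℝ (Fin n)) +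
    h • (LinearMap.id -
      (V.starProjection : EuclideanSpace ℝ (Fin n) →ₗ[ℝ] EuclideanSpace ℝ (Fin n)))

lemma anisotropicScaling_apply (r h : ℝ) (x : EuclideanSpace ℝ (Fin n)) :
    anisotropicScaling V r h x = r • V.starProjection x + h • (x - V.starProjection x) := rfl

lemma anisotropicScaling_isSymmetric (r h : ℝ) : (anisotropicScaling V r h).IsSymmetric := by
  intro x y
  simp only [anisotropicScaling_apply, inner_add_left, inner_add_right, inner_sub_left,
    inner_sub_right, real_inner_smul_left, real_inner_smul_right,
    Submodule.inner_starProjection_left_eq_right]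

lemma det_anisotropicScaling (r h : ℝ) :
    LinearMap.det (anisotropicScaling V r h) =
      r ^ Module.finrank ℝ V * h ^ (n - Module.finrank ℝ V) := by
  have hc : IsCompl V Vᗮ := V.isCompl_orthogonal
  set e := V.prodEquivOfIsCompl Vᗮ hc with he
  have hconj : anisotropicScaling V r h =
      (e : (V × Vᗮ) →ₗ[ℝ] EuclideanSpace ℝ (Fin n)) ∘ₗ
        LinearMap.prodMap (r • LinearMap.id) (h • LinearMap.id) ∘ₗ
        (e.symm : EuclideanSpace ℝ (Fin n) →ₗ[ℝ] (V × Vᗮ)) := by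
    ext1 x
    obtain ⟨⟨u, v⟩, rfl⟩ := e.surjective x
    have hP : V.starProjection (u + v : EuclideanSpace ℝ (Fin n)) = u := by
      rw [map_add, Submodule.starProjection_eq_self_iff.2 u.2,
        V.starProjection_apply_eq_zero_iff.2 v.2, add_zero]
    simp [anisotropicScaling_apply, he, hP]
  have hfin : Module.finrank ℝ Vᗮ = n - Module.finrank ℝ V := by
    have := V.finrank_add_finrank_orthogonal
    rw [finrank_euclideanSpace_fin] at this
    omega
  rw [hconj, LinearMap.det_conj, LinearMap.det_prodMap, LinearMap.det_smul, LinearMap.det_smul,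
    LinearMap.det_id, LinearMap.det_id, mul_one, mul_one, hfin]

end Anisotropic

/-- A nonempty convex set contains a ball relative to its affine span. -/
lemma exists_add_mem_of_mem_direction {E : Type*} [NormedAddCommGroup E] [NormedSpace ℝ E]
    [FiniteDimensional ℝ E] {K : Set E} (hK : Convex ℝ K) (hne : K.Nonempty) :
    ∃ x₀ ∈ K, ∃ r > 0, ∀ v ∈ (affineSpan ℝ K).direction, ‖v‖ ≤ r → x₀ + v ∈ K := by
  obtain ⟨x₀, hx₀⟩ := hne.intrinsicInterior hK
  obtain ⟨y, hy, rfl⟩ := mem_intrinsicInterior.1 hx₀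
  obtain ⟨ε, hε, hball⟩ := Metric.mem_nhds_iff.1 (mem_interior_iff_mem_nhds.1 hy)
  refine ⟨y, intrinsicInterior_subset hx₀, ε / 2, half_pos hε, fun v hv hvr => ?_⟩
  have hmem : (y : E) + v ∈ affineSpan ℝ K := by
    rw [add_comm]
    exact AffineSubspace.vadd_mem_of_mem_direction hv y.2
  have : (⟨(y : E) + v, hmem⟩ : affineSpan ℝ K) ∈ ball y ε := by
    rw [mem_ball, Subtype.dist_eq, dist_eq_norm, add_sub_cancel_left]
    linarith
  exact hball this

/-- Near a point of its domain, a convex function is bounded by a multiple of the distance to any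
nearby zero. -/
lemma exists_le_mul_norm_sub_of_eq_zero {E : Type*} [NormedAddCommGroup E] [NormedSpace ℝ E]
    [FiniteDimensional ℝ E] {Ω : Set E} {w : E → ℝ} (hΩo : IsOpen Ω) (hconv : ConvexOn ℝ Ω w)
    {x₀ : E} (hx₀ : x₀ ∈ Ω) :
    ∃ L > 0, ∃ ρ > 0, ball x₀ ρ ⊆ Ω ∧
      ∀ x ∈ ball x₀ ρ, ∀ y ∈ ball x₀ ρ, w y = 0 → w x ≤ L * ‖x - y‖ := by
  obtain ⟨L, t, ht, hL⟩ := hconv.locallyLipschitzOn hΩo hx₀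
  rw [hΩo.nhdsWithin_eq hx₀] at ht
  obtain ⟨ρ, hρ, hball⟩ := Metric.mem_nhds_iff.1 (Filter.inter_mem ht (hΩo.mem_nhds hx₀))
  refine ⟨L + 1, by positivity, ρ, hρ, fun x hx => (hball hx).2, fun x hx y hy hy0 => ?_⟩
  have h := hL.dist_le_mul x (hball hx).1 y (hball hy).1
  rw [Real.dist_eq, hy0, sub_zero, dist_eq_norm] at h
  nlinarith [le_abs_self (w x), norm_nonneg (x - y)]

/-- Comparison of exponents of two powers near zero. -/
lemma le_of_forall_mul_rpow_le {A B α β h₀ : ℝ} (hA : 0 < A) (hh₀ : 0 < h₀)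
    (H : ∀ h, 0 < h → h ≤ h₀ → A * h ^ α ≤ B * h ^ β) : β ≤ α := by
  by_contra! hlt
  have hlim : Filter.Tendsto (fun h : ℝ => B * h ^ (β - α)) (nhdsWithin 0 (Ioi 0)) (nhds 0) := by
    have h1 : Filter.Tendsto (fun h : ℝ => B * h ^ (β - α)) (nhds 0)
        (nhds (B * (0 : ℝ) ^ (β - α))) :=
      (Real.continuousAt_rpow_const 0 (β - α) (Or.inr (sub_pos.2 hlt).le)).const_mul B
    rw [Real.zero_rpow (sub_pos.2 hlt).ne', mul_zero] at h1
    exact h1.mono_left nhdsWithin_le_nhds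
  have hge : A ≤ 0 := by
    refine ge_of_tendsto hlim ?_
    filter_upwards [Ioc_mem_nhdsGT hh₀] with h hh
    have := H h hh.1 hh.2
    rwa [Real.rpow_sub hh.1, ← mul_div_assoc, le_div_iff₀ (Real.rpow_pos_of_pos hh.1 α)]
  exact absurd hA hge.not_gt

/-- **Dimension bound for a null coincidence set** (Corollary 2.5): if a nonnegative convex
`w` satisfies `|∂w(E ∩ {w>0})| ≥ λ ∫_{E ∩ {w>0}} w^q` in `Ω` and its zero set `K` is
nonempty with Lebesgue measure zero, then `dim K ≤ (n+q)/2`. -/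
theorem dimension_bound_coincidence_set
    (n : ℕ) (hn : 2 ≤ n) (q lam : ℝ) (hq0 : 0 ≤ q) (hqn : q < n) (hlam : 0 < lam)
    (Ω : Set (EuclideanSpace ℝ (Fin n))) (hΩo : IsOpen Ω) (hΩc : Convex ℝ Ω)
    (w : EuclideanSpace ℝ (Fin n) → ℝ)
    (hcont : ContinuousOn w Ω) (hconv : ConvexOn ℝ Ω w) (hnonneg : ∀ x ∈ Ω, 0 ≤ w x)
    (hMA : ∀ E : Set (EuclideanSpace ℝ (Fin n)), MeasurableSet E → E ⊆ Ω →
      ENNReal.ofReal lam * ∫⁻ x in E ∩ {x | 0 < w x}, ENNReal.ofReal (w x ^ q) ≤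
        volume (subgradImg Ω w (E ∩ {x | 0 < w x})))
    (hKne : ({x ∈ Ω | w x = 0}).Nonempty)
    (hK0 : volume {x ∈ Ω | w x = 0} = 0) :
    (Module.finrank ℝ (affineSpan ℝ {x ∈ Ω | w x = 0}).direction : ℝ) ≤ ((n : ℝ) + q) / 2 := by
  set K : Set (EuclideanSpace ℝ (Fin n)) := {x ∈ Ω | w x = 0} with hKdef
  have hKeq : K = {x ∈ Ω | w x ≤ 0} := by
    ext x
    exact ⟨fun h => ⟨h.1, h.2.le⟩, fun h => ⟨h.1, le_antisymm h.2 (hnonneg x h.1)⟩⟩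
  have hKc : Convex ℝ K := hKeq ▸ hconv.convex_le 0
  obtain ⟨x₀, hx₀, r₀, hr₀, hK⟩ := exists_add_mem_of_mem_direction hKc hKne
  obtain ⟨L, hL, ρ, hρ, hball, hlin⟩ := exists_le_mul_norm_sub_of_eq_zero hΩo hconv hx₀.1
  obtain ⟨C, hC, hmax⟩ :=
    exists_rpow_det_le (by omega) hq0 hqn hlam hcont hconv hnonneg hMA
  set V := (affineSpan ℝ K).direction with hV
  set k := Module.finrank ℝ V with hk
  have hkn : k ≤ n := by
    have := V.finrank_le
    rwa [finrank_euclideanSpace_fin] at this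
  have hnpos : (0 : ℝ) < n := by positivity
  set θ : ℝ := (n - q) / (2 * n) with hθ
  have hθpos : 0 < θ := div_pos (sub_pos.2 hqn) (by positivity)
  set r := min r₀ (ρ / 4) with hr
  have hrpos : 0 < r := lt_min hr₀ (by positivity)
  have hrρ : r ≤ ρ / 4 := min_le_right _ _
  have main : ∀ h, 0 < h → h ≤ ρ / 4 →
      C * (r ^ k) ^ (1 / n : ℝ) * h ^ (((n - k : ℕ) : ℝ) / n) ≤ (2 * L) ^ θ * h ^ θ := by
    intro h hh hhρ
    obtain ⟨c, hc, hwc⟩ : ∃ c ∈ ball x₀ h, 0 < w c := by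
      by_contra! hcon
      have hsub : ball x₀ h ⊆ K := fun y hy => by
        have hyΩ : y ∈ Ω := hball (ball_subset_ball (by linarith) hy)
        exact ⟨hyΩ, le_antisymm (hcon y hy) (hnonneg y hyΩ)⟩
      exact (measure_ball_pos volume x₀ hh).ne' (measure_mono_null hsub hK0)
    rw [mem_ball, dist_eq_norm] at hc
    have hdet := det_anisotropicScaling V r h
    have hpos : 0 < LinearMap.det (anisotropicScaling V r h) := by
      rw [hdet]
      positivity
    have hest : ∀ v ∈ closedBall (0 : EuclideanSpace ℝ (Fin n)) 1,
        ‖V.starProjection v‖ ≤ 1 ∧ ‖v - V.starProjection v‖ ≤ 1 := by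
      intro v hv
      rw [mem_closedBall_zero_iff] at hv
      refine ⟨(V.norm_starProjection_apply_le v).trans hv, ?_⟩
      rw [← Submodule.starProjection_orthogonal_val]
      exact (Vᗮ.norm_starProjection_apply_le v).trans hv
    have hbase : ∀ v ∈ closedBall (0 : EuclideanSpace ℝ (Fin n)) 1,
        ‖r • V.starProjection v‖ ≤ r := by
      intro v hv
      rw [norm_smul, Real.norm_eq_abs, abs_of_pos hrpos]
      exact mul_le_of_le_one_right hrpos.le (hest v hv).1
    have hdiff : ∀ v ∈ closedBall (0 : EuclideanSpace ℝ (Fin n)) 1,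
        ‖c + anisotropicScaling V r h v - (x₀ + r • V.starProjection v)‖ ≤ 2 * h := by
      intro v hv
      rw [anisotropicScaling_apply, show c + (r • V.starProjection v +
        h • (v - V.starProjection v)) - (x₀ + r • V.starProjection v) =
        (c - x₀) + h • (v - V.starProjection v) by abel]
      refine (norm_add_le _ _).trans ?_
      rw [norm_smul, Real.norm_eq_abs, abs_of_pos hh]
      nlinarith [(hest v hv).2]
    have hmem : ∀ v ∈ closedBall (0 : EuclideanSpace ℝ (Fin n)) 1,
        c + anisotropicScaling V r h v ∈ ball x₀ ρ := by
      intro v hv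
      rw [mem_ball, dist_eq_norm]
      calc ‖c + anisotropicScaling V r h v - x₀‖
          = ‖(c + anisotropicScaling V r h v - (x₀ + r • V.starProjection v)) +
              r • V.starProjection v‖ := by congr 1; abel
        _ ≤ 2 * h + r := (norm_add_le _ _).trans (add_le_add (hdiff v hv) (hbase v hv))
        _ < ρ := by linarith
    obtain ⟨x, hx, hxle⟩ := hmax (anisotropicScaling V r h) c
      (anisotropicScaling_isSymmetric V r h) hpos.ne' hwc fun v hv => hball (hmem v hv)
    have hzero : w (x₀ + r • V.starProjection x) = 0 :=
      (hK _ (V.smul_mem r (V.starProjection_apply_mem x))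
        ((hbase x hx).trans (min_le_left _ _))).2
    have hzmem : x₀ + r • V.starProjection x ∈ ball x₀ ρ := by
      rw [mem_ball, dist_eq_norm, add_sub_cancel_left]
      linarith [hbase x hx]
    have hwle : w (c + anisotropicScaling V r h x) ≤ 2 * L * h := by
      have := hlin _ (hmem x hx) _ hzmem hzero
      nlinarith [hdiff x hx]
    have hfinal := hxle.trans
      (Real.rpow_le_rpow (hnonneg _ (hball (hmem x hx))) hwle hθpos.le)
    rw [abs_of_pos hpos, hdet, Real.mul_rpow (by positivity) (by positivity),
      Real.mul_rpow (by positivity) hh.le, ← Real.rpow_natCast h, ← Real.rpow_mul hh.le,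
      mul_one_div, ← mul_assoc] at hfinal
    exact hfinal
  have hexp : θ ≤ ((n - k : ℕ) : ℝ) / n :=
    le_of_forall_mul_rpow_le (by positivity) (by positivity : 0 < ρ / 4) main
  rw [hθ, Nat.cast_sub hkn, div_le_div_iff₀ (by positivity) hnpos] at hexp
  nlinarith
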